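/- Let (u_j^n) solve the implicit scheme (u_j^n − u_j^{n−1})/Δt + D_−F(u_j^n, u_{j+1}^n) = D_−D_+A(u_j^n) for n ≥ 1, j ∈ ℤ, where F(u,v) = F₁(u) + F₂(v) is a monotone split flux. Then for every constant c ∈ ℝ, every ε > 0 and all j, n: (ψ_ε(u_j^n,c) − ψ_ε(u_j^{n−1},c))/Δt + D_− Q^c(u_j^n, u_{j+1}^n) − D_−D_+ |A(u_j^n) − A(c)|_ε ≤ − (1/Δx²) ∫_{u_{j+1}^n}^{u_j^n} ψ_ε''(z,c)(A(z) − A(u_{j+1}^n)) dz − (1/Δx²) ∫_{u_{j−1}^n}^{u_j^n} ψ_ε''(z,c)(A(z) − A(u_{j−1}^n)) dz, where Q^c(u,v) = ∫_c^u ψ_ε'(z,c) F₁'(z) dz + ∫_c^v ψ_ε'(z,c) F₂'(z) dz. -/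

import Mathlib

open MeasureTheory

/-- The Lipschitz approximation of the sign function. -/
noncomputable def signe (ε σ : ℝ) : ℝ :=
  if |σ| < ε then Real.sin (Real.pi * σ / (2 * ε)) else Real.sign σ

/-- `|u|_ε = ∫₀ᵘ sign_ε(z) dz`. -/
noncomputable def abse (ε u : ℝ) : ℝ := ∫ z in (0:ℝ)..u, signe ε z

/-- The entropy `ψ_ε(u,c) = ∫_c^u sign_ε(A(z) − A(c)) dz`. -/
noncomputable def psie (A : ℝ → ℝ) (ε u c : ℝ) : ℝ :=
  ∫ z in c..u, signe ε (A z - A c)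

/-- `ψ_ε''(z,c) = sign_ε'(A(z) − A(c)) A'(z)`. -/
noncomputable def psie'' (A : ℝ → ℝ) (ε z c : ℝ) : ℝ :=
  deriv (signe ε) (A z - A c) * deriv A z

/-- The numerical entropy flux
`Q^c(a,b) = ∫_c^a ψ_ε'(z,c) F₁'(z) dz + ∫_c^b ψ_ε'(z,c) F₂'(z) dz`. -/
noncomputable def QQ (A F₁ F₂ : ℝ → ℝ) (ε c a b : ℝ) : ℝ :=
  (∫ z in c..a, signe ε (A z - A c) * deriv F₁ z)
    + (∫ z in c..b, signe ε (A z - A c) * deriv F₂ z)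

theorem signe_eq_sin {ε σ : ℝ} (hε : 0 < ε) (h : |σ| ≤ ε) :
    signe ε σ = Real.sin (Real.pi * σ / (2 * ε)) := by
  unfold signe
  split_ifs with h'
  · rfl
  · have habs : |σ| = ε := le_antisymm h (not_lt.mp h')
    rcases (abs_eq hε.le).mp habs with rfl | rfl
    · rw [Real.sign_of_pos hε, show Real.pi * σ / (2 * σ) = Real.pi / 2 by field_simp,
        Real.sin_pi_div_two]
    · rw [Real.sign_of_neg (by linarith),
        show Real.pi * -ε / (2 * ε) = -(Real.pi / 2) by field_simp, Real.sin_neg,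
        Real.sin_pi_div_two]

theorem signe_of_le {ε σ : ℝ} (hε : 0 < ε) (h : ε ≤ σ) : signe ε σ = 1 := by
  rw [signe, if_neg (not_lt.mpr (h.trans (le_abs_self σ))), Real.sign_of_pos (by linarith)]

theorem signe_neg (ε σ : ℝ) : signe ε (-σ) = -signe ε σ := by
  simp only [signe, abs_neg, Real.sign_neg, mul_neg, neg_div, Real.sin_neg]
  split_ifs <;> rfl

/-- The derivative of `signe ε`, written through the clamp of `σ` to `[-ε, ε]`. -/
noncomputable def signeDeriv (ε σ : ℝ) : ℝ :=
  Real.pi / (2 * ε) * Real.cos (Real.pi * max (-ε) (min ε σ) / (2 * ε))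

theorem continuous_signeDeriv (ε : ℝ) : Continuous (signeDeriv ε) := by
  unfold signeDeriv
  fun_prop

theorem signeDeriv_neg {ε : ℝ} (hε : 0 < ε) (σ : ℝ) : signeDeriv ε (-σ) = signeDeriv ε σ := by
  have h : max (-ε) (min ε (-σ)) = -max (-ε) (min ε σ) := by
    rcases le_total ε σ with h1 | h1 <;> rcases le_total (-ε) σ with h2 | h2 <;> grind
  rw [signeDeriv, signeDeriv, h, mul_neg, neg_div, Real.cos_neg]

theorem signeDeriv_of_abs_le {ε σ : ℝ} (h : |σ| ≤ ε) :
    signeDeriv ε σ = Real.pi / (2 * ε) * Real.cos (Real.pi * σ / (2 * ε)) := by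
  rw [signeDeriv, min_eq_right (abs_le.mp h).2, max_eq_right (abs_le.mp h).1]

theorem signeDeriv_of_le {ε σ : ℝ} (hε : 0 < ε) (h : ε ≤ σ) : signeDeriv ε σ = 0 := by
  rw [signeDeriv, min_eq_left h, max_eq_right (by linarith),
    show Real.pi * ε / (2 * ε) = Real.pi / 2 by field_simp, Real.cos_pi_div_two, mul_zero]

theorem signeDeriv_nonneg {ε : ℝ} (hε : 0 < ε) (σ : ℝ) : 0 ≤ signeDeriv ε σ := by
  wlog h : 0 ≤ σ generalizing σ
  · rw [← signeDeriv_neg hε]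
    exact this _ (by linarith)
  rcases le_total ε σ with h1 | h1
  · rw [signeDeriv_of_le hε h1]
  · rw [signeDeriv_of_abs_le (by rwa [abs_of_nonneg h])]
    have hpi := Real.pi_pos
    refine mul_nonneg (by positivity) (Real.cos_nonneg_of_mem_Icc ⟨?_, ?_⟩)
    · have : 0 ≤ Real.pi * σ / (2 * ε) := by positivity
      linarith
    · rw [div_le_div_iff₀ (by positivity) two_pos]
      nlinarith

theorem hasDerivAt_signe {ε : ℝ} (hε : 0 < ε) (σ : ℝ) :
    HasDerivAt (signe ε) (signeDeriv ε σ) σ := by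
  wlog h : 0 ≤ σ generalizing σ
  · have h1 := ((this (-σ) (by linarith)).comp σ (hasDerivAt_neg σ)).neg
    rw [signeDeriv_neg hε] at h1
    refine (h1.congr_deriv (by ring)).congr_of_eventuallyEq (.of_forall fun z => ?_)
    simp [signe_neg]
  have hsin : |σ| ≤ ε → HasDerivAt (fun z => Real.sin (Real.pi * z / (2 * ε)))
      (signeDeriv ε σ) σ := by
    intro hσ
    rw [signeDeriv_of_abs_le hσ]
    refine (((hasDerivAt_id' σ).const_mul Real.pi).div_const (2 * ε)).sin.congr_deriv ?_
    ring
  rcases lt_trichotomy σ ε with h1 | rfl | h1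
  · have hσ : |σ| < ε := by rwa [abs_of_nonneg h]
    refine (hsin hσ.le).congr_of_eventuallyEq ?_
    filter_upwards [continuous_abs.continuousAt.eventually_lt continuousAt_const hσ] with z hz
    exact signe_eq_sin hε (le_of_lt hz)
  · have hl : HasDerivWithinAt (signe σ) (signeDeriv σ σ) (Set.Iic σ) σ := by
      refine (hsin (abs_of_nonneg h).le).hasDerivWithinAt.congr_of_eventuallyEq ?_
        (signe_eq_sin hε (abs_of_nonneg h).le)
      filter_upwards [self_mem_nhdsWithin,
        mem_nhdsWithin_of_mem_nhds (lt_mem_nhds (show -σ < σ by linarith))] with z hz hz'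
      exact signe_eq_sin hε (abs_le.mpr ⟨le_of_lt hz', hz⟩)
    have hr : HasDerivWithinAt (signe σ) (signeDeriv σ σ) (Set.Ici σ) σ := by
      rw [signeDeriv_of_le hε le_rfl]
      exact (hasDerivWithinAt_const σ (Set.Ici σ) (1 : ℝ)).congr
        (fun z hz => signe_of_le hε hz) (signe_of_le hε le_rfl)
    simpa [Set.Iic_union_Ici, hasDerivWithinAt_univ] using hl.union hr
  · rw [signeDeriv_of_le hε h1.le]
    refine (hasDerivAt_const σ (1 : ℝ)).congr_of_eventuallyEq ?_
    filter_upwards [lt_mem_nhds h1] with z hz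
    exact signe_of_le hε (le_of_lt hz)

theorem continuous_signe {ε : ℝ} (hε : 0 < ε) : Continuous (signe ε) :=
  continuous_iff_continuousAt.mpr fun σ => (hasDerivAt_signe hε σ).continuousAt

theorem monotone_signe {ε : ℝ} (hε : 0 < ε) : Monotone (signe ε) :=
  monotone_of_hasDerivAt_nonneg (hasDerivAt_signe hε) (signeDeriv_nonneg hε)

theorem hasDerivAt_abse {ε : ℝ} (hε : 0 < ε) (σ : ℝ) : HasDerivAt (abse ε) (signe ε σ) σ :=
  ((continuous_signe hε).integral_hasStrictDerivAt 0 σ).hasDerivAt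

theorem integral_mul_le_of_monotone {S p : ℝ → ℝ} (hS : Monotone S) (hSc : Continuous S)
    (hp : Continuous p) (hp0 : ∀ z, 0 ≤ p z) (a b : ℝ) :
    ∫ z in b..a, S z * p z ≤ S a * ∫ z in b..a, p z := by
  rw [← intervalIntegral.integral_const_mul]
  rcases le_total b a with h | h
  · refine intervalIntegral.integral_mono_on h ((hSc.mul hp).intervalIntegrable _ _)
      ((hp.const_mul _).intervalIntegrable _ _) fun z hz => ?_
    exact mul_le_mul_of_nonneg_right (hS hz.2) (hp0 z)
  · rw [intervalIntegral.integral_symm a b, intervalIntegral.integral_symm a b, neg_le_neg_iff]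
    refine intervalIntegral.integral_mono_on h ((hp.const_mul _).intervalIntegrable _ _)
      ((hSc.mul hp).intervalIntegrable _ _) fun z hz => ?_
    exact mul_le_mul_of_nonneg_right (hS hz.1) (hp0 z)

theorem integral_psie''_mul {A : ℝ → ℝ} (hA : ContDiff ℝ 1 A) {ε : ℝ} (hε : 0 < ε)
    (c a d : ℝ) :
    ∫ z in d..a, psie'' A ε z c * (A z - A d)
      = abse ε (A d - A c) - abse ε (A a - A c) + signe ε (A a - A c) * (A a - A d) := by
  have hAd : ∀ z, HasDerivAt A (deriv A z) z := fun z =>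
    (hA.differentiable one_ne_zero z).hasDerivAt
  have hpsi : (fun z => psie'' A ε z c)
      = fun z => signeDeriv ε (A z - A c) * deriv A z := by
    ext z
    rw [psie'', (hasDerivAt_signe hε _).deriv]
  have hderiv : ∀ z, HasDerivAt
      (fun z => signe ε (A z - A c) * (A z - A d) - abse ε (A z - A c))
      (psie'' A ε z c * (A z - A d)) z := by
    intro z
    have hin := (hAd z).sub_const (A c)
    have h1 := (hasDerivAt_signe hε (A z - A c)).comp z hin
    have h2 := (hasDerivAt_abse hε (A z - A c)).comp z hin
    refine ((h1.mul ((hAd z).sub_const (A d))).sub h2).congr_deriv ?_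
    rw [congrFun hpsi z]
    simp only [Function.comp_apply]
    ring
  have hcont : Continuous fun z => psie'' A ε z c * (A z - A d) := by
    refine Continuous.mul ?_ (hA.continuous.sub continuous_const)
    rw [hpsi]
    exact ((continuous_signeDeriv ε).comp (hA.continuous.sub continuous_const)).mul
      (hA.continuous_deriv le_rfl)
  rw [intervalIntegral.integral_eq_sub_of_hasDerivAt (fun z _ => hderiv z)
    (hcont.intervalIntegrable _ _)]
  ring

/-- the discrete entropy inequality for the implicit scheme
(Lemma `lemma: EntropyCalcDiscreteImpl`). -/
theorem stmt_18 (Δx Δt : ℝ) (hΔx : 0 < Δx) (hΔt : 0 < Δt)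
    (f A F₁ F₂ : ℝ → ℝ)
    (hf : ContDiff ℝ 1 f) (hA : ContDiff ℝ 1 A) (hA' : ∀ z, 0 ≤ deriv A z)
    (hF₁ : ContDiff ℝ 1 F₁) (hF₂ : ContDiff ℝ 1 F₂)
    (hF₁' : ∀ z, 0 ≤ deriv F₁ z) (hF₂' : ∀ z, deriv F₂ z ≤ 0)
    (hsum : ∀ z, deriv F₁ z + deriv F₂ z = deriv f z)
    (u : ℕ → ℤ → ℝ)
    (hscheme : ∀ n : ℕ, 1 ≤ n → ∀ j : ℤ,
      (u n j - u (n-1) j) / Δt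
        + ((F₁ (u n j) + F₂ (u n (j+1))) - (F₁ (u n (j-1)) + F₂ (u n j))) / Δx
      = (A (u n (j+1)) - 2 * A (u n j) + A (u n (j-1))) / Δx ^ 2)
    (c ε : ℝ) (hε : 0 < ε) :
    ∀ n : ℕ, 1 ≤ n → ∀ j : ℤ,
      (psie A ε (u n j) c - psie A ε (u (n-1) j) c) / Δt
        + (QQ A F₁ F₂ ε c (u n j) (u n (j+1)) - QQ A F₁ F₂ ε c (u n (j-1)) (u n j)) / Δx
        - (abse ε (A (u n (j+1)) - A c) - 2 * abse ε (A (u n j) - A c)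
            + abse ε (A (u n (j-1)) - A c)) / Δx ^ 2
      ≤ -(1 / Δx ^ 2) * (∫ z in (u n (j+1))..(u n j), psie'' A ε z c * (A z - A (u n (j+1))))
        - (1 / Δx ^ 2) * (∫ z in (u n (j-1))..(u n j), psie'' A ε z c * (A z - A (u n (j-1)))) := by
  intro n hn j
  have hScheme := hscheme n hn j
  have hScont : Continuous fun z => signe ε (A z - A c) :=
    (continuous_signe hε).comp (hA.continuous.sub continuous_const)
  have hSmono : Monotone fun z => signe ε (A z - A c) := fun x y hxy =>
    monotone_signe hε (sub_le_sub_right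
      (monotone_of_deriv_nonneg (hA.differentiable one_ne_zero) hA' hxy) _)
  have hF₁c := hF₁.continuous_deriv le_rfl
  have hF₂c := hF₂.continuous_deriv le_rfl
  have hSF₁ : Continuous fun z => signe ε (A z - A c) * deriv F₁ z := hScont.mul hF₁c
  have hSF₂ : Continuous fun z => signe ε (A z - A c) * deriv F₂ z := hScont.mul hF₂c
  have hFTC : ∀ {F : ℝ → ℝ}, ContDiff ℝ 1 F → ∀ x y, ∫ z in x..y, deriv F z = F y - F x :=
    fun hF x y => intervalIntegral.integral_deriv_eq_sub
      (fun z _ => hF.differentiable one_ne_zero z)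
      ((hF.continuous_deriv le_rfl).intervalIntegrable _ _)
  rw [integral_psie''_mul hA hε, integral_psie''_mul hA hε]
  unfold psie QQ
  set a := u n j
  set b := u (n-1) j
  set r := u n (j+1)
  set l := u n (j-1)
  set S := signe ε (A a - A c)
  have hpsi : (∫ z in c..a, signe ε (A z - A c)) - (∫ z in c..b, signe ε (A z - A c))
      ≤ S * (a - b) := by
    rw [intervalIntegral.integral_interval_sub_left (hScont.intervalIntegrable _ _)
      (hScont.intervalIntegrable _ _)]
    simpa using integral_mul_le_of_monotone hSmono hScont
      (continuous_const (y := (1 : ℝ))) (fun _ => zero_le_one) a b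
  have hflux₁ : (∫ z in c..a, signe ε (A z - A c) * deriv F₁ z)
      - (∫ z in c..l, signe ε (A z - A c) * deriv F₁ z) ≤ S * (F₁ a - F₁ l) := by
    rw [intervalIntegral.integral_interval_sub_left (hSF₁.intervalIntegrable _ _)
      (hSF₁.intervalIntegrable _ _), ← hFTC hF₁]
    exact integral_mul_le_of_monotone hSmono hScont hF₁c hF₁' a l
  have hflux₂ : (∫ z in c..r, signe ε (A z - A c) * deriv F₂ z)
      - (∫ z in c..a, signe ε (A z - A c) * deriv F₂ z) ≤ S * (F₂ r - F₂ a) := by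
    rw [intervalIntegral.integral_interval_sub_left (hSF₂.intervalIntegrable _ _)
      (hSF₂.intervalIntegrable _ _)]
    have h := integral_mul_le_of_monotone hSmono hScont hF₂c.neg
      (fun z => neg_nonneg.mpr (hF₂' z)) a r
    simp only [Pi.neg_apply, mul_neg, intervalIntegral.integral_neg] at h
    rw [hFTC hF₂] at h
    rw [intervalIntegral.integral_symm r a]
    linear_combination h
  have htime := div_le_div_of_nonneg_right hpsi hΔt.le
  have hflux := div_le_div_of_nonneg_right (add_le_add hflux₁ hflux₂) hΔx.le
  linear_combination htime + hflux + S * hScheme
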